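/- Let X ∈ ℝ^{n_x×N}, let Z ∈ ℝ^{n_z×N} have full row rank, let θ̂ = XZᵀ(ZZᵀ)⁻¹ be the ordinary least-squares estimate, and let κ ≥ 0. Then the uncertainty set Θ_N^κ is nonempty if and only if (1/N)(X − θ̂Z)(X − θ̂Z)ᵀ ⪯ (1 + κ/√N)² I_{n_x}, which in turn holds if and only if θ̂ ∈ Θ_N^κ. -/

import Mathlib

open Matrix

/-- The uncertainty set `Θ_N^κ`: all parameter matrices `θ` with
`(1/N)(X − θZ)(X − θZ)ᵀ ⪯ (1 + κ/√N)² I`. -/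
def ThetaSet (nx nz N : ℕ) (X : Matrix (Fin nx) (Fin N) ℝ)
    (Z : Matrix (Fin nz) (Fin N) ℝ) (κ : ℝ) : Set (Matrix (Fin nx) (Fin nz) ℝ) :=
  {θ | (((1 + κ / Real.sqrt N) ^ 2 : ℝ) • (1 : Matrix (Fin nx) (Fin nx) ℝ) -
      ((N : ℝ)⁻¹) • ((X - θ * Z) * (X - θ * Z)ᵀ)).PosSemidef}

/-- The ordinary least-squares residual is orthogonal to the rows of the regressor. -/
lemma ols_residual_mul_transpose {m n p : Type*} [Fintype n] [DecidableEq n] [Fintype p]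
    (X : Matrix m p ℝ) (Z : Matrix n p ℝ) (hZ : IsUnit (Z * Zᵀ).det) :
    (X - X * Zᵀ * (Z * Zᵀ)⁻¹ * Z) * Zᵀ = 0 := by
  rw [Matrix.sub_mul, Matrix.mul_assoc _ Z, Matrix.nonsing_inv_mul_cancel_right _ _ hZ, sub_self]

/-- Pythagorean decomposition: if the residual at `θ₀` is orthogonal to the rows of `Z`, the
residual Gram matrix at `θ` is the one at `θ₀` plus a Gram matrix. -/
lemma residual_mul_transpose_eq_add {m n p : Type*} [Fintype n] [Fintype p]
    {X : Matrix m p ℝ} {Z : Matrix n p ℝ} {θ₀ : Matrix m n ℝ}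
    (h : (X - θ₀ * Z) * Zᵀ = 0) (θ : Matrix m n ℝ) :
    (X - θ * Z) * (X - θ * Z)ᵀ =
      (X - θ₀ * Z) * (X - θ₀ * Z)ᵀ + ((θ₀ - θ) * Z) * ((θ₀ - θ) * Z)ᵀ := by
  have hsplit : X - θ * Z = (X - θ₀ * Z) + (θ₀ - θ) * Z := by
    rw [Matrix.sub_mul]; abel
  have hcross : (X - θ₀ * Z) * ((θ₀ - θ) * Z)ᵀ = 0 := by
    rw [transpose_mul, ← Matrix.mul_assoc, h, Matrix.zero_mul]
  have hcross' : ((θ₀ - θ) * Z) * (X - θ₀ * Z)ᵀ = 0 := by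
    simpa only [transpose_mul, transpose_transpose, transpose_zero] using congrArg transpose hcross
  rw [hsplit, transpose_add, Matrix.add_mul, Matrix.mul_add, Matrix.mul_add, hcross, hcross',
    add_zero, zero_add]

/-- With `Z` of full row rank, `θ̂ = XZᵀ(ZZᵀ)⁻¹` the OLS estimate and
`κ ≥ 0`: `Θ_N^κ` is nonempty iff `(1/N)(X − θ̂Z)(X − θ̂Z)ᵀ ⪯ (1 + κ/√N)² I`, which in
turn holds iff `θ̂ ∈ Θ_N^κ`. -/
theorem thetaSet_nonempty_iff {nx nz N : ℕ} (hnx : 1 ≤ nx) (hnz : 1 ≤ nz) (hN : 1 ≤ N)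
    (X : Matrix (Fin nx) (Fin N) ℝ) (Z : Matrix (Fin nz) (Fin N) ℝ)
    (hZ : IsUnit (Z * Zᵀ).det)
    (θhat : Matrix (Fin nx) (Fin nz) ℝ) (hθhat : θhat = X * Zᵀ * (Z * Zᵀ)⁻¹)
    (κ : ℝ) (hκ : 0 ≤ κ) :
    ((ThetaSet nx nz N X Z κ).Nonempty ↔
        (((1 + κ / Real.sqrt N) ^ 2 : ℝ) • (1 : Matrix (Fin nx) (Fin nx) ℝ) -
          ((N : ℝ)⁻¹) • ((X - θhat * Z) * (X - θhat * Z)ᵀ)).PosSemidef) ∧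
      ((((1 + κ / Real.sqrt N) ^ 2 : ℝ) • (1 : Matrix (Fin nx) (Fin nx) ℝ) -
          ((N : ℝ)⁻¹) • ((X - θhat * Z) * (X - θhat * Z)ᵀ)).PosSemidef ↔
        θhat ∈ ThetaSet nx nz N X Z κ) := by
  refine ⟨⟨?_, fun h => ⟨θhat, h⟩⟩, Iff.rfl⟩
  rintro ⟨θ, hθ⟩
  have horth : (X - θhat * Z) * Zᵀ = 0 := by
    rw [hθhat]; exact ols_residual_mul_transpose X Z hZ
  have hgram : (((θhat - θ) * Z) * ((θhat - θ) * Z)ᵀ).PosSemidef := by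
    simpa only [conjTranspose_eq_transpose_of_trivial] using
      posSemidef_self_mul_conjTranspose ((θhat - θ) * Z)
  have hsum := PosSemidef.add hθ (hgram.smul (inv_nonneg.mpr (Nat.cast_nonneg (α := ℝ) N)))
  rw [residual_mul_transpose_eq_add horth θ, smul_add, ← sub_sub, sub_add_cancel] at hsum
  exact hsum
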